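/- arXiv:1905.03009 — 4 statements merged into one kernel-verified Lean document; each statement's English description precedes it below -/
import Mathlib

section
/- Let r ≥ 2 be a real number, and let t_r be the probability measure on ℝ with density f_r(x) = Γ((r+1)/2)/(Γ(r/2)·√(rπ)) · (1 + x²/r)^{−(r+1)/2} (Student's t distribution with r degrees of freedom). Then 1/(2(r+1)) < log ρ(N(0,1), t_r) < 1/(2r), where ρ(N(0,1), t_r) is the supremum over Borel sets A of N(0,1)(A)/t_r(A). -/
open MeasureTheory ProbabilityTheory
open scoped ENNReal

/-- Student's t distribution with `r` degrees of freedom, as a measure on `ℝ`. -/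
noncomputable def studentT (r : ℝ) : Measure ℝ :=
  volume.withDensity fun x =>
    ENNReal.ofReal (Real.Gamma ((r + 1) / 2) / (Real.Gamma (r / 2) * Real.sqrt (r * Real.pi)) *
      (1 + x ^ 2 / r) ^ (-(r + 1) / 2))

/-- The ratio measure `ρ(Q,P) = sup_A Q(A)/P(A)`, computed in `[0,∞]`
(with the `ℝ≥0∞` division conventions `0/0 = 0` and `t/0 = ∞` for `t > 0`). -/
noncomputable def ratioMeasure {X : Type*} [MeasurableSpace X] (Q P : Measure X) : ℝ≥0∞ :=
  ⨆ (A : Set X) (_ : MeasurableSet A), Q A / P A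

/-- Ratio measure of two measures with continuous densities. -/
theorem ratioMeasure_eq_of_density (g f : ℝ → ℝ) (hg : Continuous g) (hf : Continuous f)
    (hf0 : ∀ x, 0 < f x) (M : ℝ) (hM : ∀ x, f x ≤ M) (C : ℝ) (hC : 0 ≤ C) (hle : ∀ x, g x ≤ C * f x) (x₀ : ℝ)
    (heq : g x₀ = C * f x₀) :
    ratioMeasure (volume.withDensity fun x => ENNReal.ofReal (g x))
      (volume.withDensity fun x => ENNReal.ofReal (f x)) = ENNReal.ofReal C := by
  set Q := (volume : Measure ℝ).withDensity fun x => ENNReal.ofReal (g x) with hQ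
  set P := (volume : Measure ℝ).withDensity fun x => ENNReal.ofReal (f x) with hP
  have hmf : Measurable fun x => ENNReal.ofReal (f x) := hf.measurable.ennreal_ofReal
  have hmg : Measurable fun x => ENNReal.ofReal (g x) := hg.measurable.ennreal_ofReal
  have key : ∀ A, MeasurableSet A → Q A ≤ ENNReal.ofReal C * P A := by
    intro A hA
    rw [hQ, hP, withDensity_apply _ hA, withDensity_apply _ hA, ← lintegral_const_mul _ hmf]
    refine lintegral_mono fun x => ?_
    rw [← ENNReal.ofReal_mul hC]
    exact ENNReal.ofReal_le_ofReal (hle x)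
  have hup : ratioMeasure Q P ≤ ENNReal.ofReal C :=
    iSup₂_le fun A hA => ENNReal.div_le_of_le_mul (key A hA)
  refine le_antisymm hup ?_
  have hfin : ratioMeasure Q P ≠ ⊤ := ne_top_of_le_ne_top ENNReal.ofReal_ne_top hup
  set R := ratioMeasure Q P with hR
  have hRA : ∀ A, MeasurableSet A → P A ≠ ⊤ → Q A ≤ R * P A := by
    intro A hA ht
    have h1 : Q A / P A ≤ R := le_iSup₂ (f := fun A (_ : MeasurableSet A) => Q A / P A) A hA
    by_cases h0 : P A = 0
    · have := key A hA
      rw [h0, mul_zero] at this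
      exact this.trans zero_le
    · exact (ENNReal.div_le_iff_le_mul (Or.inl h0) (Or.inl ht)).1 h1
  have hae : (fun x => ENNReal.ofReal (g x)) ≤ᵐ[volume] fun x => R * ENNReal.ofReal (f x) := by
    refine ae_le_of_forall_setLIntegral_le_of_sigmaFinite hmg fun s hs hsv => ?_
    rw [lintegral_const_mul _ hmf, ← withDensity_apply _ hs, ← withDensity_apply _ hs]
    refine hRA s hs (ne_top_of_le_ne_top (ENNReal.mul_ne_top (ENNReal.ofReal_ne_top (r := M)) hsv.ne) ?_)
    rw [hP, withDensity_apply _ hs, ← setLIntegral_const]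
    exact lintegral_mono fun x => ENNReal.ofReal_le_ofReal (hM x)
  have hae2 : ∀ᵐ x ∂(volume : Measure ℝ), g x ≤ R.toReal * f x := by
    filter_upwards [hae] with x hx
    rw [← ENNReal.ofReal_toReal hfin, ← ENNReal.ofReal_mul ENNReal.toReal_nonneg] at hx
    exact (ENNReal.ofReal_le_ofReal_iff (mul_nonneg ENNReal.toReal_nonneg (hf0 x).le)).1 hx
  have hcl : IsClosed {x | g x ≤ R.toReal * f x} := isClosed_le hg (continuous_const.mul hf)
  have huniv := (hcl.closure_eq).symm.trans (Measure.dense_of_ae hae2).closure_eq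
  have hx0 : x₀ ∈ {x | g x ≤ R.toReal * f x} := huniv ▸ Set.mem_univ x₀
  have h3 : C * f x₀ ≤ R.toReal * f x₀ := heq ▸ hx0
  exact ENNReal.ofReal_le_of_le_toReal (le_of_mul_le_mul_right h3 (hf0 x₀))

/-- Normalized logarithm of the Gamma quotient. -/
noncomputable def gQuot (r : ℝ) : ℝ :=
  1 / 2 * Real.log (r / 2) + Real.log (Real.Gamma (r / 2)) - Real.log (Real.Gamma ((r + 1) / 2))

theorem logGamma_add_one {z : ℝ} (hz : 0 < z) :
    Real.log (Real.Gamma (z + 1)) = Real.log z + Real.log (Real.Gamma z) := by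
  rw [Real.Gamma_add_one hz.ne', Real.log_mul hz.ne' (Real.Gamma_pos_of_pos hz).ne']

theorem logGamma_half {z : ℝ} (hz : 0 < z) :
    Real.log (Real.Gamma (z + 1 / 2)) ≤ 1 / 2 * Real.log z + Real.log (Real.Gamma z) := by
  have h := Real.convexOn_log_Gamma.2 (Set.mem_Ioi.2 hz) (Set.mem_Ioi.2 (by linarith : 0 < z + 1))
    (by norm_num : (0 : ℝ) ≤ 1 / 2) (by norm_num : (0 : ℝ) ≤ 1 / 2) (by norm_num)
  simp only [smul_eq_mul, Function.comp] at h
  rw [logGamma_add_one hz, show 1 / 2 * z + 1 / 2 * (z + 1) = z + 1 / 2 by ring] at h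
  linarith

theorem gQuot_nonneg {r : ℝ} (hr : 0 < r) : 0 ≤ gQuot r := by
  have h := logGamma_half (z := r / 2) (by positivity)
  rw [show r / 2 + 1 / 2 = (r + 1) / 2 by ring] at h
  unfold gQuot; linarith

theorem gQuot_le {r : ℝ} (hr : 0 < r) : gQuot r ≤ 1 / (2 * r) := by
  have h := logGamma_half (z := (r + 1) / 2) (by positivity)
  rw [show (r + 1) / 2 + 1 / 2 = r / 2 + 1 by ring, logGamma_add_one (by positivity)] at h
  have h2 : Real.log ((r + 1) / 2) - Real.log (r / 2) ≤ 1 / r := by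
    rw [← Real.log_div (by positivity) (by positivity)]
    refine (Real.log_le_sub_one_of_pos (by positivity)).trans (le_of_eq ?_)
    field_simp; ring
  have h3 : 1 / (2 * r) = 1 / 2 * (1 / r) := by field_simp
  unfold gQuot; rw [h3]; linarith

theorem gQuot_step {r : ℝ} (hr : 0 < r) :
    gQuot r - gQuot (r + 2) = 1 / 2 * Real.log ((r + 1) ^ 2 / (r * (r + 2))) := by
  unfold gQuot
  rw [show (r + 2) / 2 = r / 2 + 1 by ring, show (r + 2 + 1) / 2 = (r + 1) / 2 + 1 by ring,
    logGamma_add_one (by positivity), logGamma_add_one (by positivity),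
    show r / 2 + 1 = (r + 2) / 2 by ring,
    Real.log_div (by positivity) (by positivity), Real.log_div (by positivity) (by positivity),
    Real.log_div (by positivity) (by positivity), Real.log_div (by positivity) (by positivity),
    Real.log_mul (by positivity) (by positivity), Real.log_pow]
  push_cast; ring

theorem nonneg_of_step (F : ℝ → ℝ) (h1 : ∀ s, 0 < s → F (s + 2) ≤ F s)
    (h2 : ∀ s, 0 < s → -(1 / s) ≤ F s) {r : ℝ} (hr : 0 < r) : 0 ≤ F r := by
  have h3 : ∀ n : ℕ, F (r + 2 * n) ≤ F r := by
    intro n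
    induction n with
    | zero => simp
    | succ k ih =>
      have := h1 (r + 2 * k) (by positivity)
      push_cast
      rw [show r + 2 * ((k : ℝ) + 1) = r + 2 * k + 2 by ring]
      linarith
  by_contra! hneg
  obtain ⟨n, hn⟩ := exists_nat_gt (1 / (-F r))
  have hs : 0 < r + 2 * (n : ℝ) := by positivity
  have h4 := (h2 _ hs).trans (h3 n)
  have h5 : 1 < n * (-F r) := (div_lt_iff₀ (by linarith)).1 hn
  have h6 : -F r ≤ 1 / (r + 2 * n) := by linarith
  rw [le_div_iff₀ hs] at h6
  nlinarith [mul_nonneg (Nat.cast_nonneg (α := ℝ) n) (by linarith : 0 ≤ -F r)]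

theorem gQuot_upper {r : ℝ} (hr : 0 < r) : gQuot r ≤ 1 / (4 * r) := by
  have := nonneg_of_step (fun s => 1 / (4 * s) - gQuot s) (fun s hs => ?_) (fun s hs => ?_) hr
  · simpa using this
  · have h := gQuot_step hs
    have h2 := Real.log_le_sub_one_of_pos (x := (s + 1) ^ 2 / (s * (s + 2))) (by positivity)
    have h3 : 1 / (4 * s) - 1 / (4 * (s + 2)) = 1 / 2 * ((s + 1) ^ 2 / (s * (s + 2)) - 1) := by
      field_simp; ring
    linarith
  · have h := gQuot_le hs
    have : 1 / (4 * s) + 1 / s - 1 / (2 * s) = 3 / (4 * s) := by field_simp; ring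
    have h3 : 0 < 3 / (4 * s) := by positivity
    linarith

theorem gQuot_lower {r : ℝ} (hr : 0 < r) : 1 / (4 * (r + 1)) ≤ gQuot r := by
  have := nonneg_of_step (fun s => gQuot s - 1 / (4 * (s + 1))) (fun s hs => ?_) (fun s hs => ?_) hr
  · simpa using this
  · have h := gQuot_step hs
    have h2 := Real.one_sub_inv_le_log_of_pos (x := (s + 1) ^ 2 / (s * (s + 2))) (by positivity)
    have h3 : 1 / 2 * (1 - ((s + 1) ^ 2 / (s * (s + 2)))⁻¹) - (1 / (4 * (s + 1)) - 1 / (4 * (s + 2 + 1)))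
        = 1 / ((s + 1) ^ 2 * (s + 3)) := by
      field_simp; ring
    have h4 : 0 < 1 / ((s + 1) ^ 2 * (s + 3)) := by positivity
    linarith
  · have h := gQuot_nonneg hs
    have : 1 / (4 * (s + 1)) ≤ 1 / s := one_div_le_one_div_of_le hs (by linarith)
    linarith

/-- Logarithm of the supremum of the density ratio. -/
noncomputable def logRho (r : ℝ) : ℝ :=
  -(1 / 2) + (r + 1) / 2 * Real.log (1 + 1 / r) + gQuot r

theorem logRho_upper {r : ℝ} (hr : 0 < r) : logRho r < 1 / (2 * r) := by
  have h1 : 0 < 1 / r := by positivity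
  have h := Real.self_lt_sinh_iff.2 (Real.log_pos (by linarith : 1 < 1 + 1 / r))
  rw [Real.sinh_log (by positivity)] at h
  have h2 := mul_lt_mul_of_pos_left h (by positivity : 0 < (r + 1) / 2)
  have h3 : (r + 1) / 2 * ((1 + 1 / r - (1 + 1 / r)⁻¹) / 2) = 1 / 2 + 1 / (2 * r) - 1 / (4 * r) := by
    field_simp; ring
  have h4 := gQuot_upper hr
  unfold logRho; linarith

theorem logRho_lower {r : ℝ} (hr : 0 < r) : 1 / (2 * (r + 1)) < logRho r := by
  have h := Real.le_log_one_add_of_nonneg (by positivity : 0 ≤ 1 / r)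
  have h2 := mul_le_mul_of_nonneg_left h (by positivity : 0 ≤ (r + 1) / 2)
  have h3 : (r + 1) / 2 * (2 * (1 / r) / (1 / r + 2)) - 1 / 2 + 1 / (4 * (r + 1)) - 1 / (2 * (r + 1))
      = 1 / (4 * (r + 1) * (2 * r + 1)) := by
    field_simp; ring
  have h4 := gQuot_lower hr
  have h5 : 0 < 1 / (4 * (r + 1) * (2 * r + 1)) := by positivity
  unfold logRho; linarith

theorem ratioMeasure_gaussian_studentT {r : ℝ} (hr : 0 < r) :
    ratioMeasure (gaussianReal 0 1) (studentT r) = ENNReal.ofReal (Real.exp (logRho r)) := by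
  have hG1 : 0 < Real.Gamma ((r + 1) / 2) := Real.Gamma_pos_of_pos (by positivity)
  have hG2 : 0 < Real.Gamma (r / 2) := Real.Gamma_pos_of_pos (by positivity)
  have hpi := Real.pi_pos
  set K := Real.Gamma ((r + 1) / 2) / (Real.Gamma (r / 2) * Real.sqrt (r * Real.pi)) with hK
  have hK0 : 0 < K := by positivity
  have hlogK : Real.log K = - gQuot r - 1 / 2 * Real.log (2 * Real.pi) := by
    rw [hK, gQuot, Real.log_div (by positivity) (by positivity),
      Real.log_mul (by positivity) (by positivity), Real.log_sqrt (by positivity),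
      Real.log_mul (by positivity) (by positivity), Real.log_mul (by positivity) (by positivity),
      Real.log_div (by positivity) (by positivity)]
    ring
  have hb : ∀ x : ℝ, 0 < 1 + x ^ 2 / r := fun x => by positivity
  have hf : ∀ x : ℝ, K * (1 + x ^ 2 / r) ^ (-(r + 1) / 2) =
      Real.exp (- gQuot r - 1 / 2 * Real.log (2 * Real.pi)
        - (r + 1) / 2 * Real.log (1 + x ^ 2 / r)) := by
    intro x
    rw [Real.rpow_def_of_pos (hb x), ← Real.exp_log hK0, hlogK, ← Real.exp_add]
    congr 1; ring
  have hg : ∀ x : ℝ, gaussianPDFReal 0 1 x =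
      Real.exp (- (1 / 2) * Real.log (2 * Real.pi) - x ^ 2 / 2) := by
    intro x
    have h2pi : 0 < Real.sqrt (2 * Real.pi) := by positivity
    rw [gaussianPDFReal_def]
    simp only [NNReal.coe_one, mul_one, sub_zero]
    rw [← Real.exp_log (inv_pos.2 h2pi), Real.log_inv, Real.log_sqrt (by positivity),
      ← Real.exp_add]
    congr 1; ring
  rw [gaussianReal_of_var_ne_zero 0 one_ne_zero, gaussianPDF_def, studentT]
  refine ratioMeasure_eq_of_density _ _ ?_ ?_ ?_ K ?_ _ (Real.exp_pos _).le ?_ 1 ?_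
  · refine Continuous.congr ?_ (fun x => (hg x).symm)
    fun_prop
  · have : ∀ x : ℝ, 1 + x ^ 2 / r ≠ 0 := fun x => (hb x).ne'
    refine Continuous.congr ?_ (fun x => (hf x).symm)
    fun_prop (disch := assumption)
  · intro x; exact mul_pos hK0 (Real.rpow_pos_of_pos (hb x) _)
  · intro x
    refine mul_le_of_le_one_right hK0.le (Real.rpow_le_one_of_one_le_of_nonpos ?_ ?_)
    · have : 0 ≤ x ^ 2 / r := by positivity
      linarith
    · linarith
  · intro x
    rw [← hK, hf, hg, ← Real.exp_add, Real.exp_le_exp, logRho]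
    have h := Real.log_le_sub_one_of_pos (x := (1 + x ^ 2 / r) / (1 + 1 / r)) (by positivity)
    rw [Real.log_div (hb x).ne' (by positivity)] at h
    have h2 := mul_le_mul_of_nonneg_left h (by positivity : 0 ≤ (r + 1) / 2)
    have h3 : (r + 1) / 2 * ((1 + x ^ 2 / r) / (1 + 1 / r) - 1) = x ^ 2 / 2 - 1 / 2 := by
      field_simp; ring
    rw [h3] at h2
    linarith
  · rw [← hK, hf, hg, ← Real.exp_add, logRho, one_pow]
    congr 1; ring

/-- Lemma 1: for `r ≥ 2`, `1/(2(r+1)) < log ρ(N(0,1), t_r) < 1/(2r)`. -/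
theorem gaussian_studentT_ratio_bounds (r : ℝ) (hr : 2 ≤ r) :
    1 / (2 * (r + 1)) < Real.log (ratioMeasure (gaussianReal 0 1) (studentT r)).toReal ∧
    Real.log (ratioMeasure (gaussianReal 0 1) (studentT r)).toReal < 1 / (2 * r) := by
  have hr0 : 0 < r := by linarith
  rw [ratioMeasure_gaussian_studentT hr0, ENNReal.toReal_ofReal (Real.exp_pos _).le, Real.log_exp]
  exact ⟨logRho_lower hr0, logRho_upper hr0⟩
end

section
/- Define w(t) := (1/t)·(1/2 − 1/t + 1/(e^t − 1)) for t > 0 and R(x) := ∫_0^∞ e^{−tx} w(t) dt for x > 0. Then for every t > 0, 12^{−1}·e^{−t/12} < w(t) < 12^{−1}; consequently R is strictly decreasing on (0,∞) and satisfies 1/(12x + 1) < R(x) < 1/(12x) for every x > 0. -/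
open MeasureTheory

/-- The integrand in Binet's first formula for the log-gamma function. -/
noncomputable def binetW (t : ℝ) : ℝ :=
  (1 / t) * (1 / 2 - 1 / t + 1 / (Real.exp t - 1))

/-- The remainder in Binet's first formula: `R(x) = ∫_0^∞ e^{-tx} w(t) dt`. -/
noncomputable def binetR (x : ℝ) : ℝ :=
  ∫ t in Set.Ioi (0 : ℝ), Real.exp (-t * x) * binetW t

lemma pos_of_deriv_pos {f f' : ℝ → ℝ} (hd : ∀ t, HasDerivAt f (f' t) t) (h0 : f 0 = 0)
    (hp : ∀ t, 0 < t → 0 < f' t) : ∀ t, 0 < t → 0 < f t := by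
  intro t ht
  have hm : StrictMonoOn f (Set.Ici 0) := by
    apply strictMonoOn_of_deriv_pos (convex_Ici 0)
    · exact fun x _ => (hd x).continuousAt.continuousWithinAt
    · intro x hx
      rw [interior_Ici] at hx
      rw [(hd x).deriv]
      exact hp x hx
  have := hm (Set.mem_Ici.2 le_rfl) (Set.mem_Ici.2 ht.le) ht
  rwa [h0] at this

/-- Derivative of `e^t * (quintic) + (quintic)`. -/
lemma hasDerivAt_aux (a b c d e g a' b' c' d' e' g' t : ℝ) :
    HasDerivAt (fun t : ℝ => Real.exp t * (a*t^5+b*t^4+c*t^3+d*t^2+e*t+g)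
        + (a'*t^5+b'*t^4+c'*t^3+d'*t^2+e'*t+g'))
      (Real.exp t * (a*t^5+(b+5*a)*t^4+(c+4*b)*t^3+(d+3*c)*t^2+(e+2*d)*t+(g+e))
        + (0*t^5+(5*a')*t^4+(4*b')*t^3+(3*c')*t^2+(2*d')*t+e')) t := by
  have hp : ∀ a b c d e g : ℝ, HasDerivAt (fun t : ℝ => a*t^5+b*t^4+c*t^3+d*t^2+e*t+g)
      (a*(5*t^4)+b*(4*t^3)+c*(3*t^2)+d*(2*t)+e) t := by
    intro a b c d e g
    have h5 := (hasDerivAt_pow 5 t).const_mul a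
    have h4 := (hasDerivAt_pow 4 t).const_mul b
    have h3 := (hasDerivAt_pow 3 t).const_mul c
    have h2 := (hasDerivAt_pow 2 t).const_mul d
    have h1 := (hasDerivAt_id t).const_mul e
    have := ((((h5.add h4).add h3).add h2).add h1).add_const g
    exact HasDerivAt.congr_deriv this (by norm_num)
  have := ((Real.hasDerivAt_exp t).mul (hp a b c d e g)).add (hp a' b' c' d' e' g')
  exact HasDerivAt.congr_deriv this (by ring)

lemma upper_aux : ∀ t : ℝ, 0 < t →
    0 < Real.exp t * (t^2-6*t+12) - (t^2+6*t+12) := by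
  have h2 := pos_of_deriv_pos (hasDerivAt_aux 0 0 0 1 (-2) 2 0 0 0 0 0 (-2)) (by norm_num)
    (by intro t ht; norm_num; positivity)
  have h1 := pos_of_deriv_pos (hasDerivAt_aux 0 0 0 1 (-4) 6 0 0 0 0 (-2) (-6)) (by norm_num)
    (by intro t ht; have := h2 t ht; ring_nf at this ⊢; linarith)
  have h0 := pos_of_deriv_pos (hasDerivAt_aux 0 0 0 1 (-6) 12 0 0 0 (-1) (-6) (-12)) (by norm_num)
    (by intro t ht; have := h1 t ht; ring_nf at this ⊢; linarith)
  intro t ht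
  have := h0 t ht
  ring_nf at this ⊢; linarith

lemma lower_aux : ∀ t : ℝ, 0 < t →
    0 < Real.exp t * (1*t^5+(-30)*t^4+420*t^3+(-3360)*t^2+15120*t+(-30240))
      + (1*t^5+30*t^4+420*t^3+3360*t^2+15120*t+30240) := by
  have h5 := pos_of_deriv_pos (hasDerivAt_aux 1 (-5) 20 (-60) 120 (-120) 0 0 0 0 0 120)
    (by norm_num) (by intro t ht; norm_num; positivity)
  have h4 := pos_of_deriv_pos (hasDerivAt_aux 1 (-10) 60 (-240) 600 (-720) 0 0 0 0 120 720)
    (by norm_num) (by intro t ht; have := h5 t ht; ring_nf at this ⊢; linarith)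
  have h3 := pos_of_deriv_pos (hasDerivAt_aux 1 (-15) 120 (-600) 1800 (-2520) 0 0 0 60 720 2520)
    (by norm_num) (by intro t ht; have := h4 t ht; ring_nf at this ⊢; linarith)
  have h2 := pos_of_deriv_pos
    (hasDerivAt_aux 1 (-20) 200 (-1200) 4200 (-6720) 0 0 20 360 2520 6720)
    (by norm_num) (by intro t ht; have := h3 t ht; ring_nf at this ⊢; linarith)
  have h1 := pos_of_deriv_pos
    (hasDerivAt_aux 1 (-25) 300 (-2100) 8400 (-15120) 0 5 120 1260 6720 15120)
    (by norm_num) (by intro t ht; have := h2 t ht; ring_nf at this ⊢; linarith)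
  exact pos_of_deriv_pos
    (hasDerivAt_aux 1 (-30) 420 (-3360) 15120 (-30240) 1 30 420 3360 15120 30240)
    (by norm_num) (by intro t ht; have := h1 t ht; ring_nf at this ⊢; linarith)

lemma exp_aux (u : ℝ) (hu : 0 < u) :
    35 + 140*u^2 + 48*u^4 < Real.exp u * (35 + 56*u^2) := by
  have h := Real.sum_le_exp_of_nonneg hu.le 5
  norm_num [Finset.sum_range_succ, Nat.factorial] at h
  have h2 : (1 + u + u^2/2 + u^3/6 + u^4/24) * (35+56*u^2) ≤ Real.exp u * (35 + 56*u^2) := by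
    apply mul_le_mul_of_nonneg_right _ (by positivity)
    linarith
  have h3 : 0 < 35 - (133/2)*u + 45*u^2 := by nlinarith [sq_nonneg (u - 133/180)]
  have h4 : 0 ≤ u^2*(16 - 20*u + 9*u^2) :=
    mul_nonneg (sq_nonneg u) (by nlinarith [sq_nonneg (u - 10/9)])
  have h5 : 0 < u * (35 - (133/2)*u + 45*u^2 + u^2*(16 - 20*u + 9*u^2)) := by positivity
  have h6 : 0 < u^3 := by positivity
  have h7 : 0 < u^4 := by positivity
  have h8 : 0 < u^5 := by positivity
  have h9 : 0 < u^6 := by positivity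
  nlinarith

lemma binetW_eq (t : ℝ) (ht : 0 < t) :
    binetW t = (t*(Real.exp t+1) - 2*(Real.exp t-1)) / (2*t^2*(Real.exp t-1)) := by
  have : 0 < Real.exp t - 1 := by linarith [Real.add_one_lt_exp ht.ne']
  unfold binetW
  field_simp
  ring

lemma binetW_lt (t : ℝ) (ht : 0 < t) : binetW t < 12⁻¹ := by
  have hE : 0 < Real.exp t - 1 := by linarith [Real.add_one_lt_exp ht.ne']
  rw [binetW_eq t ht, div_lt_iff₀ (by positivity)]
  have := upper_aux t ht
  nlinarith

lemma lt_binetW (t : ℝ) (ht : 0 < t) : 12⁻¹ * Real.exp (-t / 12) < binetW t := by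
  have hE : 0 < Real.exp t - 1 := by linarith [Real.add_one_lt_exp ht.ne']
  have h1 : (15120+168*t^2)/(12*(15120+420*t^2+t^4)) < binetW t := by
    rw [binetW_eq t ht, div_lt_div_iff₀ (by positivity) (by positivity)]
    have := lower_aux t ht
    nlinarith
  refine lt_trans ?_ h1
  have h2 := exp_aux (t/12) (by positivity)
  rw [neg_div, Real.exp_neg, ← mul_inv, ← one_div, div_lt_div_iff₀ (by positivity) (by positivity)]
  nlinarith

lemma setInt_lt {f g : ℝ → ℝ} (hf : IntegrableOn f (Set.Ioi 0)) (hg : IntegrableOn g (Set.Ioi 0))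
    (h : ∀ t, 0 < t → f t < g t) : ∫ t in Set.Ioi (0:ℝ), f t < ∫ t in Set.Ioi (0:ℝ), g t := by
  rw [← sub_pos, ← integral_sub hg hf]
  change 0 < ∫ t in Set.Ioi (0:ℝ), (g - f) t
  rw [setIntegral_pos_iff_support_of_nonneg_ae _ (hg.sub hf)]
  · have : Set.Ioi (0:ℝ) ⊆ Function.support (g - f) ∩ Set.Ioi 0 :=
      fun t ht => ⟨(sub_pos.2 (h t ht)).ne', ht⟩
    refine lt_of_lt_of_le ?_ (measure_mono this)
    simp
  · filter_upwards [ae_restrict_mem measurableSet_Ioi] with t ht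
    exact (sub_pos.2 (h t ht)).le

lemma integrable_exp (x : ℝ) (hx : 0 < x) :
    IntegrableOn (fun t : ℝ => Real.exp (-t * x)) (Set.Ioi 0) := by
  have := integrableOn_exp_mul_Ioi (neg_lt_zero.2 hx) 0
  refine this.congr_fun (fun t _ => ?_) measurableSet_Ioi
  simp [mul_comm]

lemma integral_exp' (x : ℝ) (hx : 0 < x) :
    ∫ t in Set.Ioi (0:ℝ), Real.exp (-t * x) = 1 / x := by
  have := integral_exp_mul_Ioi (neg_lt_zero.2 hx) 0
  simp only [mul_zero, Real.exp_zero, neg_div_neg_eq] at this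
  rw [← this]
  congr 1; ext t; congr 1; ring

lemma binetW_pos (t : ℝ) (ht : 0 < t) : 0 < binetW t :=
  lt_trans (by positivity) (lt_binetW t ht)

lemma integrable_R (x : ℝ) (hx : 0 < x) :
    IntegrableOn (fun t : ℝ => Real.exp (-t * x) * binetW t) (Set.Ioi 0) := by
  have hm : Measurable binetW := by unfold binetW; fun_prop
  refine Integrable.mono' ((integrable_exp x hx).mul_const 12⁻¹) ?_ ?_
  · exact Measurable.aestronglyMeasurable (by fun_prop)
  · filter_upwards [ae_restrict_mem measurableSet_Ioi] with t ht
    have := binetW_pos t ht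
    rw [Real.norm_of_nonneg (by positivity)]
    exact mul_le_mul_of_nonneg_left (binetW_lt t ht).le (Real.exp_pos _).le

/-- Lemma 2: `12⁻¹ e^{-t/12} < w(t) < 12⁻¹` for all `t > 0`; consequently the
Binet remainder `R` is strictly decreasing on `(0,∞)` and
`1/(12x+1) < R(x) < 1/(12x)` for all `x > 0`. -/
theorem binet_remainder_bounds :
    (∀ t : ℝ, 0 < t → 12⁻¹ * Real.exp (-t / 12) < binetW t ∧ binetW t < 12⁻¹) ∧
    StrictAntiOn binetR (Set.Ioi 0) ∧
    (∀ x : ℝ, 0 < x → 1 / (12 * x + 1) < binetR x ∧ binetR x < 1 / (12 * x)) := by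
  refine ⟨fun t ht => ⟨lt_binetW t ht, binetW_lt t ht⟩, ?_, ?_⟩
  · intro x hx y hy hxy
    refine setInt_lt (integrable_R y hy) (integrable_R x hx) fun t ht => ?_
    refine mul_lt_mul_of_pos_right (Real.exp_lt_exp.2 ?_) (binetW_pos t ht)
    nlinarith
  · intro x hx
    constructor
    · have hx' : 0 < x + 1/12 := by positivity
      have h := setInt_lt ((integrable_exp _ hx').mul_const 12⁻¹) (integrable_R x hx)
        (fun t ht => by
          have h1 := mul_lt_mul_of_pos_left (lt_binetW t ht) (Real.exp_pos (-t * x))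
          have h2 : Real.exp (-t * (x + 1/12)) = Real.exp (-t*x) * Real.exp (-t/12) := by
            rw [← Real.exp_add]; congr 1; ring
          rw [h2]; linarith)
      rw [integral_mul_const, integral_exp' _ hx'] at h
      have e : 1 / (12*x+1) = 1/(x+1/12) * 12⁻¹ := by field_simp
      rw [e]; exact h
    · have h := setInt_lt (integrable_R x hx) ((integrable_exp _ hx).mul_const 12⁻¹)
        (fun t ht => mul_lt_mul_of_pos_left (binetW_lt t ht) (Real.exp_pos (-t * x)))
      rw [integral_mul_const, integral_exp' _ hx] at h
      have e : 1 / (12*x) = 1/x * 12⁻¹ := by field_simp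
      rw [e]; exact h
end

section
/- For all real numbers 0 < a < b, the quantity s(a,b) := log Γ(b) − log Γ(a) − ((b − 1/2)·log b − (a − 1/2)·log a − (b − a)) satisfies −(b − a)/(12ab) < s(a,b) < min(0, −(b − a)/(12ab) + 1/(144·a²)). -/
open Filter Topology Set

noncomputable def muF (x : ℝ) : ℝ := Real.log (Real.Gamma x) - (x - 1 / 2) * Real.log x + x

noncomputable def bigF (s c d x : ℝ) : ℝ := s * muF x + c * x⁻¹ + d * (x⁻¹) ^ 2

noncomputable def smallH (s c d x : ℝ) : ℝ :=
  s * ((x + 1 / 2) * (Real.log (x + 1) - Real.log x) - 1) + c * (x⁻¹ - (x + 1)⁻¹)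
    + d * ((x⁻¹) ^ 2 - ((x + 1)⁻¹) ^ 2)

noncomputable def smallH1 (s c d x : ℝ) : ℝ :=
  s * ((Real.log (x + 1) - Real.log x) - (x⁻¹ + (x + 1)⁻¹) / 2)
    + c * (-(x⁻¹) ^ 2 + ((x + 1)⁻¹) ^ 2)
    + d * (-2 * (x⁻¹) ^ 3 + 2 * ((x + 1)⁻¹) ^ 3)

noncomputable def smallH2 (s c d x : ℝ) : ℝ :=
  s * (((x + 1)⁻¹ - x⁻¹) - (-(x⁻¹) ^ 2 + -((x + 1)⁻¹) ^ 2) / 2)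
    + c * (2 * (x⁻¹) ^ 3 - 2 * ((x + 1)⁻¹) ^ 3)
    + d * (6 * (x⁻¹) ^ 4 - 6 * ((x + 1)⁻¹) ^ 4)

lemma bigF_diff (s c d x : ℝ) (hx : 0 < x) :
    bigF s c d x = smallH s c d x + bigF s c d (x + 1) := by
  have h1 : Real.log (Real.Gamma (x + 1)) = Real.log x + Real.log (Real.Gamma x) := by
    rw [Real.Gamma_add_one hx.ne', Real.log_mul hx.ne' (Real.Gamma_pos_of_pos hx).ne']
  unfold bigF smallH muF
  rw [h1]
  ring

lemma hasDeriv_inv (x : ℝ) (hx : 0 < x) : HasDerivAt (fun y : ℝ => y⁻¹) (-(x⁻¹) ^ 2) x := by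
  exact (hasDerivAt_inv hx.ne').congr_deriv (by rw [inv_pow])

lemma hasDeriv_inv1 (x : ℝ) (hx : 0 < x) :
    HasDerivAt (fun y : ℝ => (y + 1)⁻¹) (-((x + 1)⁻¹) ^ 2) x :=
  (hasDeriv_inv (x + 1) (by linarith)).comp_add_const x 1

lemma hasDeriv_log (x : ℝ) (hx : 0 < x) :
    HasDerivAt (fun y : ℝ => Real.log (y + 1) - Real.log y) ((x + 1)⁻¹ - x⁻¹) x :=
  ((Real.hasDerivAt_log (x := x + 1) (by linarith)).comp_add_const x 1).sub
    (Real.hasDerivAt_log hx.ne')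

lemma hasDeriv_H (s c d x : ℝ) (hx : 0 < x) :
    HasDerivAt (smallH s c d) (smallH1 s c d x) x := by
  have i0 := hasDeriv_inv x hx
  have i1 := hasDeriv_inv1 x hx
  have l := hasDeriv_log x hx
  have := ((((((hasDerivAt_id x).add_const (1 / 2)).mul l).sub_const 1).const_mul s).add
    ((i0.sub i1).const_mul c)).add (((i0.pow 2).sub (i1.pow 2)).const_mul d)
  refine this.congr_deriv ?_
  have h1 : x + 1 ≠ 0 := by linarith
  have e : (x + 1 / 2) * ((x + 1)⁻¹ - x⁻¹) = -(x⁻¹ + (x + 1)⁻¹) / 2 := by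
    field_simp
    ring
  simp only [smallH1, id]
  rw [e]
  push_cast
  ring

lemma hasDeriv_H1 (s c d x : ℝ) (hx : 0 < x) :
    HasDerivAt (smallH1 s c d) (smallH2 s c d x) x := by
  have i0 := hasDeriv_inv x hx
  have i1 := hasDeriv_inv1 x hx
  have l := hasDeriv_log x hx
  have := (((l.sub ((i0.add i1).div_const 2)).const_mul s).add
    (((i0.pow 2).neg.add (i1.pow 2)).const_mul c)).add
    ((((i0.pow 3).const_mul (-2)).add ((i1.pow 3).const_mul 2)).const_mul d)
  refine this.congr_deriv ?_
  simp only [smallH2]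
  push_cast
  ring

lemma tendsto_log_diff (c : ℝ) :
    Tendsto (fun x : ℝ => Real.log (x + c) - Real.log x) atTop (𝓝 0) :=
  Real.tendsto_log_comp_add_sub_log c

lemma tendsto_H1 (s c d : ℝ) : Tendsto (smallH1 s c d) atTop (𝓝 0) := by
  have i0 : Tendsto (fun x : ℝ => x⁻¹) atTop (𝓝 0) := tendsto_inv_atTop_zero
  have i1 : Tendsto (fun x : ℝ => (x + 1)⁻¹) atTop (𝓝 0) :=
    i0.comp (tendsto_atTop_add_const_right _ _ tendsto_id)
  have := ((((tendsto_log_diff 1).sub ((i0.add i1).div_const 2)).const_mul s).add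
    (((i0.pow 2).neg.add (i1.pow 2)).const_mul c)).add
    ((((i0.pow 3).const_mul (-2)).add ((i1.pow 3).const_mul 2)).const_mul d)
  have e : s * (0 - (0 + 0) / 2) + c * (-0 ^ 2 + 0 ^ 2) + d * (-2 * 0 ^ 3 + 2 * 0 ^ 3)
      = (0 : ℝ) := by ring
  rw [e] at this
  exact this

lemma smallH_anti (s c d : ℝ) (hp : ∀ x, 0 < x → 0 < smallH2 s c d x) :
    StrictAntiOn (smallH s c d) (Ioi 0) := by
  have hm : StrictMonoOn (smallH1 s c d) (Ioi 0) := by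
    apply strictMonoOn_of_deriv_pos (convex_Ioi 0)
    · exact fun x hx => (hasDeriv_H1 s c d x hx).continuousAt.continuousWithinAt
    · intro x hx
      rw [interior_Ioi] at hx
      rw [(hasDeriv_H1 s c d x hx).deriv]
      exact hp x hx
  apply strictAntiOn_of_deriv_neg (convex_Ioi 0)
  · exact fun x hx => (hasDeriv_H s c d x hx).continuousAt.continuousWithinAt
  · intro x hx
    rw [interior_Ioi] at hx
    rw [(hasDeriv_H s c d x hx).deriv]
    have hx' : (0 : ℝ) < x := hx
    have h1 : smallH1 s c d x < smallH1 s c d (x + 1) :=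
      hm hx (by simp only [mem_Ioi]; linarith) (by linarith)
    have h2 : smallH1 s c d (x + 1) ≤ 0 := by
      refine ge_of_tendsto (tendsto_H1 s c d) ?_
      filter_upwards [eventually_ge_atTop (x + 1)] with y hy
      exact hm.monotoneOn (by simp only [mem_Ioi]; linarith)
        (by simp only [mem_Ioi]; linarith) hy
    linarith

lemma logGamma_shift (x : ℝ) (hx : 0 < x) (n : ℕ) :
    Real.log (Real.Gamma (x + n)) =
      Real.log (Real.Gamma x) + ∑ m ∈ Finset.range n, Real.log (x + m) := by
  induction n with
  | zero => simp
  | succ k ih =>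
    have h : 0 < x + k := by positivity
    rw [Finset.sum_range_succ, ← add_assoc, ← ih]
    push_cast
    rw [← add_assoc, Real.Gamma_add_one h.ne',
      Real.log_mul h.ne' (Real.Gamma_pos_of_pos h).ne']
    ring

lemma muF_limit (x : ℝ) (hx : 0 < x) :
    Tendsto (fun n : ℕ => muF (x + (n + 1 : ℕ)) -
      (Real.log (n.factorial) - (n + 1 / 2) * Real.log n + n)) atTop (𝓝 0) := by
  have h1 := Real.BohrMollerup.tendsto_log_gamma hx
  have h2 := (tendsto_log_diff (x + 1)).comp (tendsto_natCast_atTop_atTop (R := ℝ))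
  have h3 := (Real.tendsto_mul_log_one_add_div_atTop (x + 1)).comp
    (tendsto_natCast_atTop_atTop (R := ℝ))
  have h4 := (((tendsto_const_nhds (x := Real.log (Real.Gamma x))).sub h1).sub
    (h2.const_mul (x + 1 / 2))).sub (h3.sub_const (x + 1))
  simp only [sub_self, mul_zero] at h4
  refine h4.congr' ?_
  filter_upwards [eventually_gt_atTop 0] with n hn
  have hn' : (0 : ℝ) < n := by exact_mod_cast hn
  have e : Real.log (1 + (x + 1) / n) = Real.log (n + (x + 1)) - Real.log n := by
    rw [← Real.log_div (by positivity) hn'.ne']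
    congr 1
    field_simp
  have e2 : x + ((n + 1 : ℕ) : ℝ) = n + (x + 1) := by push_cast; ring
  simp only [Function.comp, muF, e, logGamma_shift x hx (n + 1), Real.BohrMollerup.logGammaSeq]
  rw [e2]
  ring

lemma bigF_limit (s c d a b : ℝ) (ha : 0 < a) (hb : 0 < b) :
    Tendsto (fun n : ℕ => bigF s c d (a + (n + 1 : ℕ)) - bigF s c d (b + (n + 1 : ℕ)))
      atTop (𝓝 0) := by
  have iv : ∀ y : ℝ, Tendsto (fun n : ℕ => (y + (n + 1 : ℕ))⁻¹) atTop (𝓝 0) := fun y =>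
    tendsto_inv_atTop_zero.comp (tendsto_atTop_add_const_left _ _
      (tendsto_natCast_atTop_atTop.comp (tendsto_add_atTop_nat 1)))
  have := ((((muF_limit a ha).sub (muF_limit b hb)).const_mul s).add
    (((iv a).sub (iv b)).const_mul c)).add ((((iv a).pow 2).sub ((iv b).pow 2)).const_mul d)
  simp only [sub_self, mul_zero, add_zero, ne_eq, OfNat.ofNat_ne_zero, not_false_eq_true,
    zero_pow] at this
  refine this.congr fun n => ?_
  unfold bigF
  ring

lemma bigF_lt (s c d : ℝ) (hp : ∀ x, 0 < x → 0 < smallH2 s c d x) (a b : ℝ) (ha : 0 < a)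
    (hab : a < b) : bigF s c d b < bigF s c d a := by
  have hanti := smallH_anti s c d hp
  set G : ℕ → ℝ := fun n => bigF s c d (a + n) - bigF s c d (b + n) with hG
  have step : ∀ n, G (n + 1) < G n := by
    intro n
    have h1 : 0 < a + n := by positivity
    have h2 : a + n < b + n := by linarith
    have h3 := hanti (a := a + n) h1 (b := b + n) (h1.trans h2) h2
    have e1 := bigF_diff s c d (a + n) h1
    have e2 := bigF_diff s c d (b + n) (h1.trans h2)
    simp only [hG]
    push_cast
    rw [← add_assoc, ← add_assoc]
    linarith
  have hA : StrictAnti G := strictAnti_nat_of_succ_lt step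
  have h1 : 0 ≤ G 1 := by
    refine le_of_tendsto (bigF_limit s c d a b ha (ha.trans hab)) ?_
    filter_upwards with n
    exact hA.antitone (by omega)
  have h0 := step 0
  simp only [hG, Nat.cast_zero, add_zero] at h0
  simp only [hG] at h1
  simp only [zero_add] at h0
  linarith

/-- Corollary 4: refined Stirling bounds for increments of the log-gamma function.
For `0 < a < b`, `s(a,b) := log Γ(b) - log Γ(a) - ((b-1/2)log b - (a-1/2)log a - (b-a))`
satisfies `-(b-a)/(12ab) < s(a,b) < min(0, -(b-a)/(12ab) + 1/(144 a²))`. -/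
theorem log_gamma_increment_bounds (a b : ℝ) (ha : 0 < a) (hab : a < b) :
    -((b - a) / (12 * a * b)) <
      Real.log (Real.Gamma b) - Real.log (Real.Gamma a) -
        ((b - 1 / 2) * Real.log b - (a - 1 / 2) * Real.log a - (b - a)) ∧
    Real.log (Real.Gamma b) - Real.log (Real.Gamma a) -
        ((b - 1 / 2) * Real.log b - (a - 1 / 2) * Real.log a - (b - a)) <
      min 0 (-((b - a) / (12 * a * b)) + 1 / (144 * a ^ 2)) := by
  have hb : 0 < b := ha.trans hab
  have k1 : muF b < muF a := by
    have := bigF_lt 1 0 0 (fun x hx => by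
      have : smallH2 1 0 0 x = 1 / (2 * x ^ 2 * (x + 1) ^ 2) := by
        unfold smallH2
        field_simp
        ring
      rw [this]; positivity) a b ha hab
    simpa [bigF] using this
  have k2 := bigF_lt (-1) (1 / 12) 0 (fun x hx => by
      have : smallH2 (-1) (1 / 12) 0 x = 1 / (6 * x ^ 3 * (x + 1) ^ 3) := by
        unfold smallH2
        field_simp
        ring
      rw [this]; positivity) a b ha hab
  have k3 := bigF_lt 1 (-1 / 12) (1 / 144) (fun x hx => by
      have : smallH2 1 (-1 / 12) (1 / 144) x =
          (4 * x ^ 3 + 2 * x ^ 2 + 1) / (24 * x ^ 4 * (x + 1) ^ 4) := by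
        unfold smallH2
        field_simp
        ring
      rw [this]; positivity) a b ha hab
  have e : (b - a) / (12 * a * b) = 1 / 12 * a⁻¹ - 1 / 12 * b⁻¹ := by
    field_simp
  have e2 : 1 / (144 * a ^ 2) = 1 / 144 * (a⁻¹) ^ 2 := by
    field_simp
  have e3 : 0 < (b⁻¹) ^ 2 := by positivity
  unfold bigF at k2 k3
  unfold muF at k1 k2 k3
  rw [e, e2]
  refine ⟨by linarith, lt_min (by linarith) (by linarith)⟩
end

section
/- Let h(x) := log Γ(x). Then for every x > 0, h(x + 1/2) − h(x) − (log x)/2 < −1/(8(x + 1/2)), and for every x > 1/2, h(x + 1/2) − h(x) − (log x)/2 > −1/(8x) − 1/(24x(4x² − 1)). -/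
open Filter Topology

noncomputable def gammaD (x : ℝ) : ℝ :=
  Real.log (Real.Gamma (x + 1 / 2)) - Real.log (Real.Gamma x) - Real.log x / 2

lemma logGamma_succ {x : ℝ} (hx : 0 < x) :
    Real.log (Real.Gamma (x + 1)) = Real.log x + Real.log (Real.Gamma x) := by
  rw [Real.Gamma_add_one hx.ne', Real.log_mul hx.ne' (Real.Gamma_pos_of_pos hx).ne']

lemma logGamma_mid {x : ℝ} (hx : 0 < x) :
    Real.log (Real.Gamma (x + 1 / 2)) ≤
      (Real.log (Real.Gamma x) + Real.log (Real.Gamma (x + 1))) / 2 := by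
  have hx1 : x + 1 ∈ Set.Ioi (0 : ℝ) := by simp only [Set.mem_Ioi]; linarith
  have h := Real.convexOn_log_Gamma.2 (Set.mem_Ioi.2 hx) hx1
    (by norm_num : (0 : ℝ) ≤ 1 / 2) (by norm_num : (0 : ℝ) ≤ 1 / 2) (by norm_num)
  simp only [smul_eq_mul, Function.comp] at h
  rw [show 1 / 2 * x + 1 / 2 * (x + 1) = x + 1 / 2 by ring] at h
  linarith

lemma gammaD_nonpos {x : ℝ} (hx : 0 < x) : gammaD x ≤ 0 := by
  have h := logGamma_mid hx
  rw [logGamma_succ hx] at h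
  unfold gammaD
  linarith

lemma gammaD_ge {x : ℝ} (hx : 0 < x) : -(1 / (4 * x)) ≤ gammaD x := by
  have h := logGamma_mid (x := x + 1 / 2) (by linarith)
  rw [logGamma_succ (x := x + 1 / 2) (by linarith), show x + 1 / 2 + 1 / 2 = x + 1 by ring,
    logGamma_succ hx] at h
  have h2 := Real.log_le_sub_one_of_pos (x := (x + 1 / 2) / x) (by positivity)
  rw [Real.log_div (by positivity) hx.ne'] at h2
  have h3 : (x + 1 / 2) / x - 1 = 2 * (1 / (4 * x)) := by field_simp; ring
  unfold gammaD
  linarith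

lemma gammaD_step {x : ℝ} (hx : 0 < x) :
    gammaD (x + 1) - gammaD x = Real.log (x + 1 / 2) - (Real.log x + Real.log (x + 1)) / 2 := by
  have h := logGamma_succ (x := x + 1 / 2) (by linarith)
  have h1 := logGamma_succ hx
  unfold gammaD
  rw [show x + 1 + 1 / 2 = x + 1 / 2 + 1 by ring]
  linarith

lemma gammaD_step_gt {x : ℝ} (hx : 0 < x) :
    1 / (2 * (2 * x + 1) ^ 2) < gammaD (x + 1) - gammaD x := by
  rw [gammaD_step hx]
  have hne : x * (x + 1) / (x + 1 / 2) ^ 2 ≠ 1 := by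
    intro h
    rw [div_eq_iff (by positivity)] at h
    nlinarith
  have h2 := Real.log_lt_sub_one_of_pos (x := x * (x + 1) / (x + 1 / 2) ^ 2) (by positivity) hne
  rw [Real.log_div (by positivity) (by positivity), Real.log_mul (by positivity) (by positivity),
    Real.log_pow] at h2
  have h3 : x * (x + 1) / (x + 1 / 2) ^ 2 - 1 = -2 * (1 / (2 * (2 * x + 1) ^ 2)) := by
    field_simp; ring
  push_cast at h2
  linarith

lemma gammaD_step_le {x : ℝ} (hx : 0 < x) :
    gammaD (x + 1) - gammaD x ≤ 1 / (8 * x * (x + 1)) := by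
  rw [gammaD_step hx]
  have h2 := Real.log_le_sub_one_of_pos (x := (x + 1 / 2) ^ 2 / (x * (x + 1))) (by positivity)
  rw [Real.log_div (by positivity) (by positivity), Real.log_mul (by positivity) (by positivity),
    Real.log_pow] at h2
  have h3 : (x + 1 / 2) ^ 2 / (x * (x + 1)) - 1 = 2 * (1 / (8 * x * (x + 1))) := by
    field_simp; ring
  push_cast at h2
  linarith

lemma neg_of_step (g : ℝ → ℝ) (a : ℝ) (hg : ∀ y, a < y → g y < g (y + 1))
    (ht : Tendsto g atTop (𝓝 0)) (x : ℝ) (hx : a < x) : g x < 0 := by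
  have hm : StrictMono (fun n : ℕ => g (x + n)) := by
    apply strictMono_nat_of_lt_succ
    intro n
    have := hg (x + n) (by have : (0 : ℝ) ≤ n := n.cast_nonneg
                           linarith)
    push_cast
    rwa [← add_assoc]
  have ht2 : Tendsto (fun n : ℕ => g (x + n)) atTop (𝓝 0) :=
    ht.comp (tendsto_atTop_add_const_left _ x tendsto_natCast_atTop_atTop)
  have h1 := hm.monotone.ge_of_tendsto ht2 1
  have h2 := hm (show 0 < 1 by norm_num)
  simp only [Nat.cast_zero, add_zero] at h2
  exact h2.trans_le h1

lemma tendsto_one_div_of {f : ℝ → ℝ} (hf : Tendsto f atTop atTop) :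
    Tendsto (fun x => 1 / f x) atTop (𝓝 0) := by
  simp only [one_div]
  exact hf.inv_tendsto_atTop

lemma tendsto_gammaD : Tendsto gammaD atTop (𝓝 0) := by
  have h : Tendsto (fun x : ℝ => -(1 / (4 * x))) atTop (𝓝 0) := by
    simpa using (tendsto_one_div_of (tendsto_id.const_mul_atTop (by norm_num : (0 : ℝ) < 4))).neg
  refine tendsto_of_tendsto_of_tendsto_of_le_of_le' h tendsto_const_nhds ?_ ?_
  · filter_upwards [eventually_gt_atTop 0] with x hx using gammaD_ge hx
  · filter_upwards [eventually_gt_atTop 0] with x hx using gammaD_nonpos hx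


/-- Lemma 3: bounds for `h(x+1/2) - h(x) - (log x)/2` where `h = log Γ`:
it is `< -1/(8(x+1/2))` for all `x > 0`, and `> -1/(8x) - 1/(24x(4x²-1))`
for all `x > 1/2`. -/
theorem log_gamma_half_increment_bounds :
    (∀ x : ℝ, 0 < x →
      Real.log (Real.Gamma (x + 1 / 2)) - Real.log (Real.Gamma x) - Real.log x / 2 <
        -(1 / (8 * (x + 1 / 2)))) ∧
    (∀ x : ℝ, 1 / 2 < x →
      -(1 / (8 * x)) - 1 / (24 * x * (4 * x ^ 2 - 1)) <
        Real.log (Real.Gamma (x + 1 / 2)) - Real.log (Real.Gamma x) - Real.log x / 2) := by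
  constructor
  · intro x hx
    have key := neg_of_step (fun y => gammaD y + 1 / (8 * (y + 1 / 2))) 0 ?_ ?_ x hx
    · simp only [gammaD] at key
      linarith
    · intro y hy
      have h := gammaD_step_gt hy
      have h2 : 1 / (8 * (y + 1 / 2)) - 1 / (8 * (y + 1 + 1 / 2)) < 1 / (2 * (2 * y + 1) ^ 2) := by
        rw [show 1 / (8 * (y + 1 / 2)) - 1 / (8 * (y + 1 + 1 / 2))
          = 1 / (2 * ((2 * y + 1) * (2 * y + 3))) by field_simp; ring]
        apply one_div_lt_one_div_of_lt (by positivity)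
        nlinarith
      linarith
    · simpa using tendsto_gammaD.add (tendsto_one_div_of
        ((tendsto_atTop_add_const_right _ (1 / 2 : ℝ) tendsto_id).const_mul_atTop
          (by norm_num : (0 : ℝ) < 8)))
  · intro x hx
    have key := neg_of_step
      (fun y => -gammaD y - (1 / (8 * y) + 1 / (24 * y * (4 * y ^ 2 - 1)))) (1 / 2) ?_ ?_ x hx
    · simp only [gammaD] at key
      linarith
    · intro y hy
      have hy0 : 0 < y := by linarith
      have h := gammaD_step_le hy0
      have ha : 0 < 2 * y - 1 := by linarith
      have e1 : 4 * y ^ 2 - 1 = (2 * y - 1) * (2 * y + 1) := by ring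
      have e2 : 4 * (y + 1) ^ 2 - 1 = (2 * y + 1) * (2 * y + 3) := by ring
      have h2 : (1 / (8 * y) + 1 / (24 * y * (4 * y ^ 2 - 1)))
          - (1 / (8 * (y + 1)) + 1 / (24 * (y + 1) * (4 * (y + 1) ^ 2 - 1)))
          = 1 / (8 * y * (y + 1)) + 1 / (8 * y * (y + 1) * ((2 * y - 1) * (2 * y + 3))) := by
        rw [e1, e2]
        have n1 : 2 * y + 1 ≠ 0 := by positivity
        have n2 : 2 * y + 3 ≠ 0 := by positivity
        obtain ⟨t, ht⟩ : ∃ t, t = 2 * y - 1 := ⟨_, rfl⟩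
        have hy' : y = (t + 1) / 2 := by linarith
        have ht0 : 0 < t := by linarith
        rw [← ht]
        subst hy'
        field_simp
        ring
      have h3 : 0 < 1 / (8 * y * (y + 1) * ((2 * y - 1) * (2 * y + 3))) := by positivity
      linarith
    · have t1 := tendsto_one_div_of (tendsto_id.const_mul_atTop (by norm_num : (0 : ℝ) < 8))
      have t2 : Tendsto (fun y : ℝ => 1 / (24 * y * (4 * y ^ 2 - 1))) atTop (𝓝 0) := by
        apply tendsto_one_div_of
        apply (tendsto_id.const_mul_atTop (by norm_num : (0 : ℝ) < 24)).atTop_mul_atTop₀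
        exact tendsto_atTop_add_const_right _ (-1 : ℝ)
          ((tendsto_pow_atTop two_ne_zero).const_mul_atTop (by norm_num : (0 : ℝ) < 4))
      simpa using tendsto_gammaD.neg.sub (t1.add t2)
end
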